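/- The Maslov index of a pairwise transverse triple of Lagrangians in (ℝ^{2n}, ω) lies in the set {−n, −n+2, …, n−2, n}, every value of this set is attained by some pairwise transverse triple, and two pairwise transverse triples (L1,L2,L3) and (L1',L2',L3') have the same Maslov index if and only if there exists g ∈ Sp(2n,ℝ) with g·L_i = L_i' for i = 1,2,3. In other words, the Maslov index induces a bijection between the Sp(2n,ℝ)-orbits of pairwise transverse triples of Lagrangians and {−n, −n+2, …, n−2, n}. -/

import Mathlib

open Matrix

noncomputable section

/-- The symplectic vector space `ℝ^{2n}`, with coordinates indexed by `Fin n ⊕ Fin n`. -/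
abbrev V2 (n : ℕ) : Type := (Fin n ⊕ Fin n) → ℝ

/-- The standard matrix `J = [[0, Id],[−Id, 0]]`. -/
def Jn (n : ℕ) : Matrix (Fin n ⊕ Fin n) (Fin n ⊕ Fin n) ℝ :=
  Matrix.fromBlocks 0 1 (-1) 0

/-- The standard symplectic form `ω(x,y) = ᵀx J y` on `ℝ^{2n}`. -/
def omegaForm (n : ℕ) (x y : V2 n) : ℝ := x ⬝ᵥ (Jn n).mulVec y

/-- A subspace is Lagrangian if it has dimension `n` and `ω` vanishes on it. -/
def IsLagrangian (n : ℕ) (L : Submodule ℝ (V2 n)) : Prop :=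
  Module.finrank ℝ L = n ∧ ∀ x ∈ L, ∀ y ∈ L, omegaForm n x y = 0

/-- Membership in `Sp(2n,ℝ)`: `ᵀg J g = J`. -/
def IsSymplectic (n : ℕ) (g : Matrix (Fin n ⊕ Fin n) (Fin n ⊕ Fin n) ℝ) : Prop :=
  gᵀ * Jn n * g = Jn n

/-- `φ : L → L'` is the map whose graph is `M`, i.e. `M = {e + φ e : e ∈ L}`. -/
def IsGraphMap (n : ℕ) (L M L' : Submodule ℝ (V2 n)) (φ : L →ₗ[ℝ] L') : Prop :=
  ∀ x : V2 n, x ∈ M ↔ ∃ e : L, x = (e : V2 n) + (φ e : V2 n)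

/-- The largest dimension of a subspace on which `q` is positive definite. -/
def posIndex {V : Type*} [AddCommGroup V] [Module ℝ V] (q : V → ℝ) : ℕ :=
  sSup {d : ℕ | ∃ W : Submodule ℝ V, Module.finrank ℝ W = d ∧ ∀ v ∈ W, v ≠ 0 → 0 < q v}

/-- The signature `p − q` of a quadratic form on a real vector space. -/
def signatureQ {V : Type*} [AddCommGroup V] [Module ℝ V] (q : V → ℝ) : ℤ :=
  (posIndex q : ℤ) - (posIndex (fun v => -q v) : ℤ)

/-- The (extended) Maslov index of a triple of Lagrangians: the signature of the
quadratic form `γ(v,w,x) = ω(v,w) + ω(w,x) + ω(x,v)` on `L1 ⊕ L2 ⊕ L3`. -/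
def maslov (n : ℕ) (L1 L2 L3 : Submodule ℝ (V2 n)) : ℤ :=
  signatureQ (fun p : ↥L1 × ↥L2 × ↥L3 =>
    omegaForm n (p.1 : V2 n) (p.2.1 : V2 n) + omegaForm n (p.2.1 : V2 n) (p.2.2 : V2 n) +
      omegaForm n (p.2.2 : V2 n) (p.1 : V2 n))

open Module QuadraticMap

section Signature

variable {V W : Type*} [AddCommGroup V] [Module ℝ V] [AddCommGroup W] [Module ℝ W]

lemma posIndex_congr (e : V ≃ₗ[ℝ] W) {q : V → ℝ} {q' : W → ℝ} (h : ∀ v, q' (e v) = q v) :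
    posIndex q = posIndex q' := by
  unfold posIndex
  congr 1
  ext d
  constructor
  · rintro ⟨U, rfl, hU⟩
    refine ⟨U.map (e : V →ₗ[ℝ] W), e.finrank_map_eq U, ?_⟩
    rintro _ ⟨v, hv, rfl⟩ hne
    change 0 < q' (e v)
    rw [h]
    exact hU v hv fun h0 => hne (by simp [h0])
  · rintro ⟨U, rfl, hU⟩
    refine ⟨U.map (e.symm : W →ₗ[ℝ] V), e.symm.finrank_map_eq U, ?_⟩
    rintro _ ⟨v, hv, rfl⟩ hne
    change 0 < q (e.symm v)
    rw [← h, e.apply_symm_apply]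
    exact hU v hv fun h0 => hne (by simp [h0])

lemma signatureQ_congr (e : V ≃ₗ[ℝ] W) {q : V → ℝ} {q' : W → ℝ} (h : ∀ v, q' (e v) = q v) :
    signatureQ q = signatureQ q' := by
  unfold signatureQ
  rw [posIndex_congr e h, posIndex_congr (q := fun v => -q v) (q' := fun v => -q' v) e (by simp [h])]

lemma posIndex_quadraticForm [FiniteDimensional ℝ V] (Q : QuadraticForm ℝ V) :
    posIndex Q = sigPos Q := by
  refine Eq.trans ?_ (sigPos_isGreatest Q).csSup_eq
  unfold posIndex
  congr! 5 with d U
  simp only [QuadraticMap.PosDef, Subtype.forall, QuadraticMap.restrict_apply]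
  simp

lemma signatureQ_weightedSumSquares {ι : Type*} [Fintype ι] (w : ι → ℝ) :
    signatureQ (fun v : ι → ℝ => ∑ i, w i * v i ^ 2) =
      ({i | 0 < w i}.ncard : ℤ) - ({i | w i < 0}.ncard : ℤ) := by
  have h₁ : (fun v : ι → ℝ => ∑ i, w i * v i ^ 2) = weightedSumSquares ℝ w := by
    ext v; simp [weightedSumSquares_apply, pow_two]
  have h₂ : (fun v => -(weightedSumSquares ℝ w) v) = ⇑(-weightedSumSquares ℝ w) := rfl
  rw [h₁, signatureQ, h₂, posIndex_quadraticForm, posIndex_quadraticForm,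
    sigPos_neg, QuadraticForm.sigPos_weightedSumSquares,
    QuadraticForm.sigNeg_weightedSumSquares]

/-- A nondegenerate symmetric bilinear form on a real space has an orthonormal basis, up to
signs. -/
lemma exists_signed_orthonormal [FiniteDimensional ℝ V] {n : ℕ} (hn : finrank ℝ V = n)
    (B : LinearMap.BilinForm ℝ V) (hsymm : ∀ x y, B x y = B y x)
    (hB : ∀ x, (∀ y, B x y = 0) → x = 0) :
    ∃ (w : Fin n → ℝ) (e : Fin n → V), (∀ i, w i = -1 ∨ w i = 1) ∧
      ∀ i j, B (e i) (e j) = if i = j then w i else 0 := by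
  subst hn
  have hassoc : associated (R := ℝ) B.toQuadraticMap = B :=
    associated_left_inverse ℝ hsymm
  obtain ⟨w, hw, ⟨T⟩⟩ := QuadraticForm.equivalent_one_neg_one_weighted_sum_squared
    B.toQuadraticMap (by rw [hassoc]; exact hB)
  refine ⟨w, fun i => T.symm (Pi.single i 1), hw, fun i j => ?_⟩
  have hT : ∀ x, B (T.symm x) (T.symm x) = ∑ k, w k * (x k * x k) := fun x => by
    have := T.symm.map_app x
    rwa [weightedSumSquares_apply] at this
  have hadd := hT (Pi.single i 1 + Pi.single j 1)
  have hi := hT (Pi.single i 1)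
  have hj := hT (Pi.single j 1)
  have key : ∑ k, w k * ((Pi.single i 1 + Pi.single j 1 : Fin _ → ℝ) k *
      (Pi.single i 1 + Pi.single j 1 : Fin _ → ℝ) k) =
      ∑ k, w k * ((Pi.single i 1 : Fin _ → ℝ) k * (Pi.single i 1 : Fin _ → ℝ) k) +
      ∑ k, w k * ((Pi.single j 1 : Fin _ → ℝ) k * (Pi.single j 1 : Fin _ → ℝ) k) +
      2 * if i = j then w i else 0 := by
    have : (if i = j then w i else 0) =
        ∑ k, w k * ((Pi.single i 1 : Fin _ → ℝ) k * (Pi.single j 1 : Fin _ → ℝ) k) := by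
      simp [Pi.single_apply, eq_comm]
      grind
    rw [this, Finset.mul_sum, ← Finset.sum_add_distrib, ← Finset.sum_add_distrib]
    exact Finset.sum_congr rfl fun k _ => by simp only [Pi.add_apply]; ring
  have hmap : T.symm (Pi.single i 1 + Pi.single j 1) =
    T.symm (Pi.single i 1) + T.symm (Pi.single j 1) := map_add T.symm.toLinearEquiv _ _
  rw [hmap, key, ← hi, ← hj] at hadd
  simp only [map_add, LinearMap.add_apply] at hadd
  linarith [hsymm (T.symm (Pi.single i 1)) (T.symm (Pi.single j 1))]

end Signature

section Omega

variable {n : ℕ}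

/-- The standard symplectic form as a bilinear form. -/
def omegaBilin (n : ℕ) : LinearMap.BilinForm ℝ (V2 n) := Matrix.toBilin' (Jn n)

lemma omegaBilin_apply (x y : V2 n) : omegaBilin n x y = omegaForm n x y :=
  Matrix.toBilin'_apply' _ _ _

lemma omegaForm_eq_sum (x y : V2 n) :
    omegaForm n x y = ∑ i, (x (Sum.inl i) * y (Sum.inr i) - x (Sum.inr i) * y (Sum.inl i)) := by
  simp only [omegaForm, Jn, dotProduct, Matrix.fromBlocks_mulVec, Fintype.sum_sum_type]
  simp [Finset.sum_sub_distrib, ← sub_eq_add_neg, Matrix.neg_mulVec, Function.comp_def]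

lemma omegaForm_swap (x y : V2 n) : omegaForm n x y = -omegaForm n y x := by
  rw [omegaForm_eq_sum, omegaForm_eq_sum, ← Finset.sum_neg_distrib]
  exact Finset.sum_congr rfl fun i _ => by ring

lemma omegaForm_nondegenerate (x : V2 n) (h : ∀ y, omegaForm n x y = 0) : x = 0 := by
  ext a
  rcases a with i | i
  · simpa [omegaForm_eq_sum, Pi.single_apply] using h (Pi.single (Sum.inr i) 1)
  · simpa [omegaForm_eq_sum, Pi.single_apply] using h (Pi.single (Sum.inl i) 1)

lemma omegaForm_mulVec (g : Matrix (Fin n ⊕ Fin n) (Fin n ⊕ Fin n) ℝ) (x y : V2 n) :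
    omegaForm n (g *ᵥ x) (g *ᵥ y) = x ⬝ᵥ (gᵀ * Jn n * g) *ᵥ y := by
  rw [omegaForm, Matrix.dotProduct_mulVec x, ← Matrix.vecMul_vecMul, ← Matrix.vecMul_vecMul,
    Matrix.vecMul_transpose, ← Matrix.dotProduct_mulVec, ← Matrix.dotProduct_mulVec]

lemma IsSymplectic.omegaForm_mulVec {g : Matrix (Fin n ⊕ Fin n) (Fin n ⊕ Fin n) ℝ}
    (hg : IsSymplectic n g) (x y : V2 n) :
    omegaForm n (g *ᵥ x) (g *ᵥ y) = omegaForm n x y := by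
  rw [_root_.omegaForm_mulVec, hg, omegaForm]

lemma isSymplectic_iff_mem_symplecticGroup {g : Matrix (Fin n ⊕ Fin n) (Fin n ⊕ Fin n) ℝ} :
    IsSymplectic n g ↔ g ∈ Matrix.symplecticGroup (Fin n) ℝ := by
  have hJ : Jn n = -Matrix.J (Fin n) ℝ := by
    simp [Jn, Matrix.J, Matrix.fromBlocks_neg]
  rw [SymplecticGroup.mem_iff', IsSymplectic, hJ]
  simp

lemma IsSymplectic.injective {g : Matrix (Fin n ⊕ Fin n) (Fin n ⊕ Fin n) ℝ}
    (hg : IsSymplectic n g) : Function.Injective g.mulVecLin := by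
  rw [← LinearMap.ker_eq_bot, LinearMap.ker_eq_bot']
  intro x hx
  refine omegaForm_nondegenerate x fun y => ?_
  rw [← hg.omegaForm_mulVec, ← Matrix.mulVecLin_apply, hx]
  simp [omegaForm]

lemma maslov_map {g : Matrix (Fin n ⊕ Fin n) (Fin n ⊕ Fin n) ℝ} (hg : IsSymplectic n g)
    (L₁ L₂ L₃ : Submodule ℝ (V2 n)) :
    maslov n (L₁.map g.mulVecLin) (L₂.map g.mulVecLin) (L₃.map g.mulVecLin) =
      maslov n L₁ L₂ L₃ := by
  let e (L : Submodule ℝ (V2 n)) := L.equivMapOfInjective g.mulVecLin hg.injective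
  refine (signatureQ_congr ((e L₁).prodCongr ((e L₂).prodCongr (e L₃))) fun p => ?_).symm
  simp [e, hg.omegaForm_mulVec]

end Omega

section DiagonalLagrangians

variable {n : ℕ}

/-- The linear map `x ↦ (a x, b x)`, with `a` and `b` acting diagonally. -/
def diagMap (a b : Fin n → ℝ) : (Fin n → ℝ) →ₗ[ℝ] V2 n where
  toFun x := Sum.elim (a * x) (b * x)
  map_add' x y := by ext (i | i) <;> simp [mul_add]
  map_smul' c x := by ext (i | i) <;> simp

@[simp] lemma diagMap_inl (a b x : Fin n → ℝ) (i : Fin n) :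
    diagMap a b x (Sum.inl i) = a i * x i := rfl

@[simp] lemma diagMap_inr (a b x : Fin n → ℝ) (i : Fin n) :
    diagMap a b x (Sum.inr i) = b i * x i := rfl

/-- The subspace `{(a x, b x)}` of `ℝ^{2n}`. -/
def diagLagrangian (a b : Fin n → ℝ) : Submodule ℝ (V2 n) := LinearMap.range (diagMap a b)

lemma diagMap_injective {a b : Fin n → ℝ} (h : ∀ i, a i ≠ 0 ∨ b i ≠ 0) :
    Function.Injective (diagMap a b) := by
  intro x y hxy
  ext i
  rcases h i with h | h
  · exact mul_left_cancel₀ h (congrFun hxy (Sum.inl i))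
  · exact mul_left_cancel₀ h (congrFun hxy (Sum.inr i))

lemma isLagrangian_diagLagrangian {a b : Fin n → ℝ} (h : ∀ i, a i ≠ 0 ∨ b i ≠ 0) :
    IsLagrangian n (diagLagrangian a b) := by
  constructor
  · rw [diagLagrangian, LinearMap.finrank_range_of_inj (diagMap_injective h)]
    simp
  · rintro _ ⟨x, rfl⟩ _ ⟨y, rfl⟩
    rw [omegaForm_eq_sum]
    exact Finset.sum_eq_zero fun i _ => by simp only [diagMap_inl, diagMap_inr]; ring

lemma diagLagrangian_inf_eq_bot {a b c d : Fin n → ℝ} (h : ∀ i, a i * d i - b i * c i ≠ 0) :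
    diagLagrangian a b ⊓ diagLagrangian c d = ⊥ := by
  rw [Submodule.eq_bot_iff]
  rintro _ ⟨⟨x, rfl⟩, ⟨y, hy⟩⟩
  have hx : x = 0 := by
    ext i
    have h₁ := congrFun hy (Sum.inl i)
    have h₂ := congrFun hy (Sum.inr i)
    simp only [diagMap_inl, diagMap_inr] at h₁ h₂
    refine (mul_eq_zero.1 (?_ : (a i * d i - b i * c i) * x i = 0)).resolve_left (h i)
    linear_combination c i * h₂ - d i * h₁
  simp [hx]

/-- The sign vector that is `1` on `S` and `-1` elsewhere. -/
def signVec (S : Finset (Fin n)) (i : Fin n) : ℝ := if i ∈ S then 1 else -1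

lemma signVec_mul_self (S : Finset (Fin n)) (i : Fin n) : signVec S i * signVec S i = 1 := by
  unfold signVec; split_ifs <;> norm_num

lemma signVec_ne_zero (S : Finset (Fin n)) (i : Fin n) : signVec S i ≠ 0 :=
  left_ne_zero_of_mul_eq_one (signVec_mul_self S i)

/-- Linear coordinates in which the form defining the Maslov index of a diagonal triple is a signed
sum of squares. -/
def maslovCoord (s : Fin n → ℝ) :
    (Fin n ⊕ Fin n ⊕ Fin n → ℝ) ≃ₗ[ℝ] (Fin n → ℝ) × (Fin n → ℝ) × (Fin n → ℝ) where
  toFun v := (fun i => v (.inl i),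
    fun i => v (.inl i) + v (.inr (.inl i)) + v (.inr (.inr i)),
    fun i => v (.inr (.inl i)) - v (.inr (.inr i)) - s i * v (.inl i))
  invFun p := Sum.elim p.1 (Sum.elim
    (fun i => (p.2.1 i - p.1 i + p.2.2 i + s i * p.1 i) / 2)
    (fun i => (p.2.1 i - p.1 i - p.2.2 i - s i * p.1 i) / 2))
  map_add' v w := by ext i <;> simp <;> ring
  map_smul' c v := by ext i <;> simp <;> ring
  left_inv v := by ext (i | i | i) <;> simp <;> ring
  right_inv p := by ext i <;> simp <;> ring

lemma maslov_diagLagrangian (S : Finset (Fin n)) :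
    maslov n (diagLagrangian 1 0) (diagLagrangian 1 (signVec S)) (diagLagrangian 0 1) =
      2 * S.card - n := by
  have h₁ : Function.Injective (diagMap (1 : Fin n → ℝ) 0) := diagMap_injective (by simp)
  have h₂ : Function.Injective (diagMap 1 (signVec S)) := diagMap_injective (by simp)
  have h₃ : Function.Injective (diagMap (0 : Fin n → ℝ) 1) := diagMap_injective (by simp)
  let w : Fin n ⊕ Fin n ⊕ Fin n → ℝ := Sum.elim (signVec S) (Sum.elim 1 (-1))
  have hsig : maslov n (diagLagrangian 1 0) (diagLagrangian 1 (signVec S)) (diagLagrangian 0 1) =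
      signatureQ (fun v : Fin n ⊕ Fin n ⊕ Fin n → ℝ => ∑ i, w i * v i ^ 2) := by
    refine (signatureQ_congr ((maslovCoord (signVec S)).trans
      ((LinearEquiv.ofInjective _ h₁).prodCongr ((LinearEquiv.ofInjective _ h₂).prodCongr
        (LinearEquiv.ofInjective _ h₃)))) fun v => ?_).symm
    simp only [omegaForm_eq_sum, maslovCoord, w, Fintype.sum_sum_type, LinearEquiv.trans_apply,
      LinearEquiv.prodCongr_apply, LinearEquiv.ofInjective_apply, LinearEquiv.coe_mk,
      LinearMap.coe_mk, AddHom.coe_mk, diagMap_inl, diagMap_inr, ← Finset.sum_add_distrib]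
    refine Finset.sum_congr rfl fun i _ => ?_
    simp
    ring
  have hpos : {i | 0 < w i} = ↑((S.disjSum (Finset.univ.disjSum ∅)) :
      Finset (Fin n ⊕ Fin n ⊕ Fin n)) := by
    ext (i | i | i)
    · by_cases hi : i ∈ S <;> simp [w, signVec, hi]
    all_goals simp [w]
  have hneg : {i | w i < 0} = ↑((Sᶜ.disjSum (Finset.disjSum ∅ Finset.univ)) :
      Finset (Fin n ⊕ Fin n ⊕ Fin n)) := by
    ext (i | i | i)
    · by_cases hi : i ∈ S <;> simp [w, signVec, hi]
    all_goals simp [w]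
  rw [hsig, signatureQ_weightedSumSquares, hpos, hneg, Set.ncard_coe_finset, Set.ncard_coe_finset]
  have := S.card_add_card_compl
  simp only [Finset.card_disjSum, Finset.card_empty, Finset.card_univ, Fintype.card_fin] at this ⊢
  lia

end DiagonalLagrangians

section Frames

variable {n : ℕ}

/-- A symplectic basis `e, f` of `ℝ^{2n}` such that `L₁` contains `e`, `L₃` contains `f`, and `L₂`
contains the vectors `e i ± f i`, with the sign `+` exactly for `i ∈ S`. -/
structure IsAdaptedFrame (S : Finset (Fin n)) (L₁ L₂ L₃ : Submodule ℝ (V2 n))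
    (e f : Fin n → V2 n) : Prop where
  omega_left : ∀ i j, omegaForm n (e i) (e j) = 0
  omega_right : ∀ i j, omegaForm n (f i) (f j) = 0
  omega_mixed : ∀ i j, omegaForm n (e i) (f j) = if i = j then 1 else 0
  mem_left : ∀ i, e i ∈ L₁
  mem_mid : ∀ i, e i + signVec S i • f i ∈ L₂
  mem_right : ∀ i, f i ∈ L₃

/-- The matrix with columns `e` and `f`. -/
def frameMatrix (e f : Fin n → V2 n) : Matrix (Fin n ⊕ Fin n) (Fin n ⊕ Fin n) ℝ :=
  (Matrix.of (Sum.elim e f))ᵀ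

lemma frameMatrix_mulVec (e f : Fin n → V2 n) (x : V2 n) :
    frameMatrix e f *ᵥ x = ∑ i, (x (Sum.inl i) • e i + x (Sum.inr i) • f i) := by
  rw [frameMatrix, Matrix.mulVec_transpose, Matrix.vecMul_eq_sum, Fintype.sum_sum_type,
    Finset.sum_add_distrib]
  rfl

lemma IsAdaptedFrame.isSymplectic {S : Finset (Fin n)} {L₁ L₂ L₃ : Submodule ℝ (V2 n)}
    {e f : Fin n → V2 n} (h : IsAdaptedFrame S L₁ L₂ L₃ e f) :
    IsSymplectic n (frameMatrix e f) := by
  have hent : ∀ a b, ((frameMatrix e f)ᵀ * Jn n * frameMatrix e f) a b =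
      omegaForm n (Sum.elim e f a) (Sum.elim e f b) := fun a b => by
    have := omegaForm_mulVec (frameMatrix e f) (Pi.single a 1) (Pi.single b 1)
    simp only [Matrix.mulVec_single_one, single_one_dotProduct] at this
    exact this.symm
  ext (i | i) (j | j) <;> rw [hent]
  · simp [h.omega_left, Jn]
  · simp [h.omega_mixed, Jn, Matrix.one_apply]
  · simp [omegaForm_swap (f i), h.omega_mixed, Jn, Matrix.one_apply, eq_comm]
  · simp [h.omega_right, Jn]

lemma map_frameMatrix_diagLagrangian {e f : Fin n → V2 n}
    (hinj : Function.Injective (frameMatrix e f).mulVecLin) {a b : Fin n → ℝ}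
    (hab : ∀ i, a i ≠ 0 ∨ b i ≠ 0) {L : Submodule ℝ (V2 n)} (hL : finrank ℝ L = n)
    (hmem : ∀ i, a i • e i + b i • f i ∈ L) :
    (diagLagrangian a b).map (frameMatrix e f).mulVecLin = L := by
  refine Submodule.eq_of_le_of_finrank_eq ?_ ?_
  · rintro _ ⟨_, ⟨x, rfl⟩, rfl⟩
    rw [Matrix.mulVecLin_apply, frameMatrix_mulVec]
    refine L.sum_mem fun i _ => ?_
    convert L.smul_mem (x i) (hmem i) using 1
    simp only [diagMap_inl, diagMap_inr, smul_add, smul_smul, mul_comm]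
  · rw [hL, ← (Submodule.equivMapOfInjective _ hinj _).finrank_eq,
      (isLagrangian_diagLagrangian hab).1]

lemma IsAdaptedFrame.exists_isSymplectic {S : Finset (Fin n)} {L₁ L₂ L₃ : Submodule ℝ (V2 n)}
    {e f : Fin n → V2 n} (h : IsAdaptedFrame S L₁ L₂ L₃ e f) (h₁ : finrank ℝ L₁ = n)
    (h₂ : finrank ℝ L₂ = n) (h₃ : finrank ℝ L₃ = n) :
    ∃ g, IsSymplectic n g ∧ (diagLagrangian 1 0).map g.mulVecLin = L₁ ∧
      (diagLagrangian 1 (signVec S)).map g.mulVecLin = L₂ ∧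
      (diagLagrangian 0 1).map g.mulVecLin = L₃ := by
  have hinj := h.isSymplectic.injective
  exact ⟨_, h.isSymplectic,
    map_frameMatrix_diagLagrangian hinj (by simp) h₁ (by simpa using h.mem_left),
    map_frameMatrix_diagLagrangian hinj (by simp) h₂ (by simpa using h.mem_mid),
    map_frameMatrix_diagLagrangian hinj (by simp) h₃ (by simpa using h.mem_right)⟩

lemma IsAdaptedFrame.reindex {S T : Finset (Fin n)} {L₁ L₂ L₃ : Submodule ℝ (V2 n)}
    {e f : Fin n → V2 n} (h : IsAdaptedFrame S L₁ L₂ L₃ e f) (σ : Equiv.Perm (Fin n))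
    (hσ : ∀ i, σ i ∈ S ↔ i ∈ T) : IsAdaptedFrame T L₁ L₂ L₃ (e ∘ σ) (f ∘ σ) where
  omega_left i j := h.omega_left _ _
  omega_right i j := h.omega_right _ _
  omega_mixed i j := by simp [h.omega_mixed]
  mem_left i := h.mem_left _
  mem_mid i := by simpa [signVec, hσ] using h.mem_mid (σ i)
  mem_right i := h.mem_right _

lemma IsLagrangian.isCompl {L L' : Submodule ℝ (V2 n)} (hL : IsLagrangian n L)
    (hL' : IsLagrangian n L') (h : L ⊓ L' = ⊥) : IsCompl L L' :=
  (Submodule.isCompl_iff_disjoint _ _ (by simp [hL.1, hL'.1])).2 (disjoint_iff.2 h)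

lemma exists_isAdaptedFrame {L₁ L₂ L₃ : Submodule ℝ (V2 n)} (hL₁ : IsLagrangian n L₁)
    (hL₂ : IsLagrangian n L₂) (hL₃ : IsLagrangian n L₃) (h₁₂ : L₁ ⊓ L₂ = ⊥)
    (h₂₃ : L₂ ⊓ L₃ = ⊥) (h₁₃ : L₁ ⊓ L₃ = ⊥) :
    ∃ S e f, IsAdaptedFrame S L₁ L₂ L₃ e f := by
  have hc := (hL₂.isCompl hL₃ h₂₃).symm
  let φ : V2 n →ₗ[ℝ] V2 n := -(L₃.projection L₂ hc)
  have hφ₃ : ∀ x, φ x ∈ L₃ := fun x => L₃.neg_mem (by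
    rw [← Submodule.coe_projectionOnto_apply]; exact Subtype.mem _)
  have hφ₂ : ∀ x, x + φ x ∈ L₂ := fun x => by
    rw [← Submodule.projectionOnto_apply_eq_zero_iff hc, ← Submodule.coe_eq_zero, map_add,
      Submodule.coe_add, Submodule.projectionOnto_apply_of_mem_left hc (hφ₃ x),
      Submodule.coe_projectionOnto_apply]
    simp [φ]
  let B : LinearMap.BilinForm ℝ L₁ := (omegaBilin n).compl₁₂ L₁.subtype (φ ∘ₗ L₁.subtype)
  have hB : ∀ x y : L₁, B x y = omegaForm n (x : V2 n) (φ y) := fun x y => omegaBilin_apply _ _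
  have hsymm : ∀ x y, B x y = B y x := fun x y => by
    have h := hL₂.2 _ (hφ₂ x) _ (hφ₂ y)
    rw [← omegaBilin_apply] at h
    simp only [map_add, LinearMap.add_apply, omegaBilin_apply, hL₁.2 _ x.2 _ y.2,
      hL₃.2 _ (hφ₃ x) _ (hφ₃ y), omegaForm_swap (φ x)] at h
    rw [hB, hB]
    linarith
  have hnondeg : ∀ x, (∀ y, B x y = 0) → x = 0 := fun x hx => by
    have hφx : φ x = 0 := by
      refine omegaForm_nondegenerate _ fun y => ?_
      obtain ⟨u, hu, v, hv, rfl⟩ := Submodule.mem_sup.1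
        ((hL₁.isCompl hL₃ h₁₃).sup_eq_top ▸ Submodule.mem_top : y ∈ L₁ ⊔ L₃)
      have h := hx ⟨u, hu⟩
      rw [hsymm, hB] at h
      rw [← omegaBilin_apply, map_add, omegaBilin_apply, omegaBilin_apply, omegaForm_swap, h,
        hL₃.2 _ (hφ₃ x) _ hv]
      simp
    have hx₂ : (x : V2 n) ∈ L₁ ⊓ L₂ := ⟨x.2, by simpa [hφx] using hφ₂ x⟩
    rw [h₁₂] at hx₂
    exact Subtype.ext ((Submodule.mem_bot ℝ).1 hx₂)
  obtain ⟨w, e, hw, he⟩ := exists_signed_orthonormal hL₁.1 B hsymm hnondeg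
  let S : Finset (Fin n) := Finset.univ.filter fun i => w i = 1
  have hS : signVec S = w := by
    ext i
    rcases hw i with h | h <;> norm_num [signVec, S, h]
  refine ⟨S, fun i => e i, fun i => signVec S i • φ (e i), ?_, ?_, ?_, ?_, ?_, ?_⟩
  · exact fun i j => hL₁.2 _ (e i).2 _ (e j).2
  · exact fun i j => hL₃.2 _ (L₃.smul_mem _ (hφ₃ _)) _ (L₃.smul_mem _ (hφ₃ _))
  · intro i j
    rw [← omegaBilin_apply, map_smul, omegaBilin_apply, ← hB, he, ← hS]
    split_ifs with h
    · rw [h, smul_eq_mul, signVec_mul_self]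
    · simp
  · exact fun i => (e i).2
  · intro i
    rw [smul_smul, signVec_mul_self, one_smul]
    exact hφ₂ _
  · exact fun i => L₃.smul_mem _ (hφ₃ _)

lemma IsAdaptedFrame.maslov_eq {S : Finset (Fin n)} {L₁ L₂ L₃ : Submodule ℝ (V2 n)}
    {e f : Fin n → V2 n} (h : IsAdaptedFrame S L₁ L₂ L₃ e f) (h₁ : finrank ℝ L₁ = n)
    (h₂ : finrank ℝ L₂ = n) (h₃ : finrank ℝ L₃ = n) : maslov n L₁ L₂ L₃ = 2 * S.card - n := by
  obtain ⟨g, hg, rfl, rfl, rfl⟩ := h.exists_isSymplectic h₁ h₂ h₃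
  rw [maslov_map hg, maslov_diagLagrangian]

end Frames

theorem maslov_classifies_transverse_triples (n : ℕ) :
    -- range: `μ ∈ {−n, −n+2, …, n}`
    (∀ L1 L2 L3 : Submodule ℝ (V2 n),
      IsLagrangian n L1 → IsLagrangian n L2 → IsLagrangian n L3 →
      L1 ⊓ L2 = ⊥ → L2 ⊓ L3 = ⊥ → L1 ⊓ L3 = ⊥ →
      (maslov n L1 L2 L3).natAbs ≤ n ∧ maslov n L1 L2 L3 ≡ (n : ℤ) [ZMOD 2]) ∧
    -- every value in `{−n, −n+2, …, n}` is attained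
    (∀ m : ℤ, m.natAbs ≤ n → m ≡ (n : ℤ) [ZMOD 2] →
      ∃ L1 L2 L3 : Submodule ℝ (V2 n),
        IsLagrangian n L1 ∧ IsLagrangian n L2 ∧ IsLagrangian n L3 ∧
        L1 ⊓ L2 = ⊥ ∧ L2 ⊓ L3 = ⊥ ∧ L1 ⊓ L3 = ⊥ ∧ maslov n L1 L2 L3 = m) ∧
    -- the Maslov index separates exactly the `Sp(2n,ℝ)`-orbits
    (∀ L1 L2 L3 L1' L2' L3' : Submodule ℝ (V2 n),
      IsLagrangian n L1 → IsLagrangian n L2 → IsLagrangian n L3 →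
      IsLagrangian n L1' → IsLagrangian n L2' → IsLagrangian n L3' →
      L1 ⊓ L2 = ⊥ → L2 ⊓ L3 = ⊥ → L1 ⊓ L3 = ⊥ →
      L1' ⊓ L2' = ⊥ → L2' ⊓ L3' = ⊥ → L1' ⊓ L3' = ⊥ →
      (maslov n L1 L2 L3 = maslov n L1' L2' L3' ↔
        ∃ g, IsSymplectic n g ∧ L1.map g.mulVecLin = L1' ∧ L2.map g.mulVecLin = L2' ∧
          L3.map g.mulVecLin = L3')) := by
  refine ⟨fun L₁ L₂ L₃ hL₁ hL₂ hL₃ h₁₂ h₂₃ h₁₃ => ?_, fun m hm hmod => ?_,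
    fun L₁ L₂ L₃ L₁' L₂' L₃' hL₁ hL₂ hL₃ hL₁' hL₂' hL₃' h₁₂ h₂₃ h₁₃ h₁₂' h₂₃' h₁₃' =>
      ⟨fun heq => ?_, ?_⟩⟩
  · obtain ⟨S, e, f, h⟩ := exists_isAdaptedFrame hL₁ hL₂ hL₃ h₁₂ h₂₃ h₁₃
    have hS := S.card_le_univ
    rw [Fintype.card_fin] at hS
    rw [h.maslov_eq hL₁.1 hL₂.1 hL₃.1, Int.ModEq]
    lia
  · rw [Int.ModEq] at hmod
    obtain ⟨S, -, hS⟩ := Finset.exists_subset_card_eq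
      (s := (Finset.univ : Finset (Fin n))) (n := ((m + n) / 2).toNat)
      (by rw [Finset.card_univ, Fintype.card_fin]; lia)
    refine ⟨diagLagrangian 1 0, diagLagrangian 1 (signVec S), diagLagrangian 0 1,
      isLagrangian_diagLagrangian (by simp), isLagrangian_diagLagrangian (by simp),
      isLagrangian_diagLagrangian (by simp),
      diagLagrangian_inf_eq_bot (by simp [signVec_ne_zero]), diagLagrangian_inf_eq_bot (by simp),
      diagLagrangian_inf_eq_bot (by simp), ?_⟩
    rw [maslov_diagLagrangian, hS]
    lia
  · obtain ⟨S, e, f, h⟩ := exists_isAdaptedFrame hL₁ hL₂ hL₃ h₁₂ h₂₃ h₁₃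
    obtain ⟨T, e', f', h'⟩ := exists_isAdaptedFrame hL₁' hL₂' hL₃' h₁₂' h₂₃' h₁₃'
    have hcard : T.card = S.card := by
      rw [h.maslov_eq hL₁.1 hL₂.1 hL₃.1, h'.maslov_eq hL₁'.1 hL₂'.1 hL₃'.1] at heq
      lia
    obtain ⟨σ, rfl⟩ := Equiv.Perm.exists_map_finset_eq _ _ hcard
    obtain ⟨g, hg, rfl, rfl, rfl⟩ :=
      (h.reindex σ (T := T) (by simp)).exists_isSymplectic hL₁.1 hL₂.1 hL₃.1
    obtain ⟨g', hg', rfl, rfl, rfl⟩ := h'.exists_isSymplectic hL₁'.1 hL₂'.1 hL₃'.1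
    rw [isSymplectic_iff_mem_symplecticGroup] at hg hg'
    let k := (⟨g, hg⟩ : Matrix.symplecticGroup (Fin n) ℝ)⁻¹
    have hk : (k : Matrix _ _ ℝ) * g = 1 := congrArg Subtype.val (inv_mul_cancel (⟨g, hg⟩ :
      Matrix.symplecticGroup (Fin n) ℝ))
    have hmul : g' * k * g = g' := by rw [Matrix.mul_assoc, hk, Matrix.mul_one]
    refine ⟨g' * k, isSymplectic_iff_mem_symplecticGroup.2 (mul_mem hg' k.2), ?_, ?_, ?_⟩ <;>
      rw [← Submodule.map_comp, ← Matrix.mulVecLin_mul, hmul]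
  · rintro ⟨g, hg, rfl, rfl, rfl⟩
    exact (maslov_map hg _ _ _).symm
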